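/- arXiv:1212.0969 — 2 statements merged into one kernel-verified Lean document; each statement's English description precedes it below -/
import Mathlib

section
/- Let E be a separable Banach space admitting an unconditional atomic decomposition ({x_j'}, {x_j}). Then the decomposition is boundedly complete (∑_j x''(x_j') x_j converges in E for every x'' ∈ E'') if and only if E contains no subspace isomorphic to c₀. -/
open Filter Topology

/-- **Rosenthal's disjointification lemma** for nonnegative superadditive set functions. -/
theorem exists_injective_offDiag_le {ε : ℝ} (n : ℕ) (ν : ℕ → Set ℕ → ℝ)
    (hnonneg : ∀ k A, 0 ≤ ν k A)
    (hadd : ∀ k A B, Disjoint A B → ν k A + ν k B ≤ ν k (A ∪ B))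
    (hbound : ∀ k, ν k {k}ᶜ ≤ n * ε) (hε : 0 ≤ ε) :
    ∃ σ : ℕ → ℕ, Function.Injective σ ∧ ∀ k, ν (σ k) (σ '' {k}ᶜ) ≤ ε := by
  induction n generalizing ν with
  | zero =>
    refine ⟨id, Function.injective_id, fun k => ?_⟩
    have := hbound k
    simp only [Nat.cast_zero, zero_mul] at this
    simpa using this.trans hε
  | succ n ih =>
    by_cases hp : ∃ p, ∀ k, ν (Nat.pair p k) (Nat.pair p '' {k}ᶜ) ≤ ε
    · obtain ⟨p, hp⟩ := hp
      exact ⟨Nat.pair p, fun a b hab => (Nat.pair_eq_pair.1 hab).2, hp⟩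
    push Not at hp
    choose κ hκ using hp
    set τ : ℕ → ℕ := fun p => Nat.pair p (κ p) with hτ
    have hτi : Function.Injective τ := fun a b hab => (Nat.pair_eq_pair.1 hab).1
    have hmono : ∀ k A B, A ⊆ B → ν k A ≤ ν k B := fun k A B hAB => by
      have h := hadd k A (B \ A) Set.disjoint_sdiff_right
      rw [Set.union_sdiff_cancel hAB] at h
      linarith [hnonneg k (B \ A)]
    obtain ⟨σ, hσ, hle⟩ := ih (fun p B => ν (τ p) (τ '' B)) (fun _ _ => hnonneg _ _)
      (fun p A B hAB => by
        simpa only [Set.image_union] using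
          hadd (τ p) _ _ ((Set.disjoint_image_iff hτi).2 hAB))
      (fun p => by
        have hd : Disjoint (τ '' {p}ᶜ) (Nat.pair p '' {κ p}ᶜ) := by
          rw [Set.disjoint_left]
          rintro _ ⟨q, hq, rfl⟩ ⟨r, -, hr⟩
          exact hq (Nat.pair_eq_pair.1 hr).1.symm
        have hs : τ '' {p}ᶜ ∪ Nat.pair p '' {κ p}ᶜ ⊆ {τ p}ᶜ := by
          rintro _ (⟨q, hq, rfl⟩ | ⟨r, hr, rfl⟩) h
          · exact hq (hτi h)
          · exact hr (Nat.pair_eq_pair.1 h).2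
        have h1 := hadd (τ p) _ _ hd
        have h2 := hmono (τ p) _ _ hs
        have h3 := hbound (τ p)
        have h4 := hκ p
        push_cast at h3
        linarith)
    exact ⟨τ ∘ σ, hτi.comp hσ, fun k => by
      rw [Set.image_comp]
      exact hle k⟩

section WeaklyUnconditionallyCauchy

variable {E : Type*} [NormedAddCommGroup E] [NormedSpace ℝ E]

theorem sum_abs_dual_le {u : ℕ → E} {K : ℝ} (hK : ∀ F : Finset ℕ, ‖∑ i ∈ F, u i‖ ≤ K)
    (φ : E →L[ℝ] ℝ) (F : Finset ℕ) : ∑ i ∈ F, |φ (u i)| ≤ 2 * K * ‖φ‖ := by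
  have key : ∀ G : Finset ℕ, |∑ i ∈ G, φ (u i)| ≤ K * ‖φ‖ := fun G => by
    rw [← map_sum, ← Real.norm_eq_abs, mul_comm]
    exact (φ.le_opNorm _).trans (mul_le_mul_of_nonneg_left (hK G) (norm_nonneg _))
  rw [← Finset.sum_filter_add_sum_filter_not F (fun i => 0 ≤ φ (u i))]
  have h1 : ∑ i ∈ F with 0 ≤ φ (u i), |φ (u i)| = ∑ i ∈ F with 0 ≤ φ (u i), φ (u i) :=
    Finset.sum_congr rfl fun i hi => abs_of_nonneg (Finset.mem_filter.1 hi).2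
  have h2 : ∑ i ∈ F with ¬ 0 ≤ φ (u i), |φ (u i)| = -∑ i ∈ F with ¬ 0 ≤ φ (u i), φ (u i) := by
    rw [← Finset.sum_neg_distrib]
    exact Finset.sum_congr rfl fun i hi =>
      abs_of_neg (not_le.1 (Finset.mem_filter.1 hi).2)
  rw [h1, h2]
  have h3 := (abs_le.1 (key {i ∈ F | 0 ≤ φ (u i)})).2
  have h4 := (abs_le.1 (key {i ∈ F | ¬ 0 ≤ φ (u i)})).1
  linarith

theorem summable_abs_dual {u : ℕ → E} {K : ℝ} (hK : ∀ F : Finset ℕ, ‖∑ i ∈ F, u i‖ ≤ K)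
    (φ : E →L[ℝ] ℝ) : Summable fun i => |φ (u i)| :=
  summable_of_sum_le (fun _ => abs_nonneg _) (sum_abs_dual_le hK φ)

theorem norm_sum_smul_le {u : ℕ → E} {K : ℝ} (hK : ∀ F : Finset ℕ, ‖∑ i ∈ F, u i‖ ≤ K)
    {a : ℕ → ℝ} {r : ℝ} (hr : 0 ≤ r) {F : Finset ℕ} (ha : ∀ i ∈ F, |a i| ≤ r) :
    ‖∑ i ∈ F, a i • u i‖ ≤ 2 * K * r := by
  have hK0 : 0 ≤ K := by simpa using hK ∅
  refine NormedSpace.norm_le_dual_bound ℝ _ (by positivity) fun φ => ?_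
  rw [map_sum, Real.norm_eq_abs]
  calc |∑ i ∈ F, φ (a i • u i)| ≤ ∑ i ∈ F, |φ (a i • u i)| := Finset.abs_sum_le_sum_abs _ _
    _ ≤ ∑ i ∈ F, r * |φ (u i)| := Finset.sum_le_sum fun i hi => by
        rw [map_smul, smul_eq_mul, abs_mul]
        exact mul_le_mul_of_nonneg_right (ha i hi) (abs_nonneg _)
    _ = r * ∑ i ∈ F, |φ (u i)| := by rw [Finset.mul_sum]
    _ ≤ r * (2 * K * ‖φ‖) := mul_le_mul_of_nonneg_left (sum_abs_dual_le hK φ F) hr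
    _ = 2 * K * r * ‖φ‖ := by ring

theorem abs_apply_le_norm (a : ZeroAtInftyContinuousMap ℕ ℝ) (n : ℕ) : |a n| ≤ ‖a‖ :=
  a.toBCF.norm_coe_le_norm n

theorem summable_smul_of_zeroAtInfty [CompleteSpace E] {u : ℕ → E} {K : ℝ}
    (hK : ∀ F : Finset ℕ, ‖∑ i ∈ F, u i‖ ≤ K) (a : ZeroAtInftyContinuousMap ℕ ℝ) :
    Summable fun n => a n • u n := by
  have hK0 : 0 ≤ K := by simpa using hK ∅
  rw [summable_iff_vanishing_norm]
  intro ε hε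
  have hη : 0 < ε / (2 * K + 1) := by positivity
  have ha : ∀ᶠ n in cofinite, |a n| < ε / (2 * K + 1) := by
    have h := a.zero_at_infty'
    rw [cocompact_eq_cofinite] at h
    simpa using Metric.tendsto_nhds.1 h _ hη
  refine ⟨(eventually_cofinite.1 ha).toFinset, fun t ht => ?_⟩
  refine (norm_sum_smul_le hK hη.le fun i hi => ?_).trans_lt ?_
  · by_contra! hlt
    exact Finset.disjoint_left.1 ht hi (by simpa using hlt.le)
  · rw [mul_div_assoc', div_lt_iff₀ (by positivity)]
    nlinarith

/-- The operator `a ↦ ∑ aₙ uₙ` on `c₀`. -/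
noncomputable def zeroAtInftySum [CompleteSpace E] {u : ℕ → E} {K : ℝ}
    (hK : ∀ F : Finset ℕ, ‖∑ i ∈ F, u i‖ ≤ K) : ZeroAtInftyContinuousMap ℕ ℝ →L[ℝ] E :=
  LinearMap.mkContinuous
    { toFun := fun a => ∑' n, a n • u n
      map_add' := fun a b => by
        simp only [ZeroAtInftyContinuousMap.add_apply, add_smul]
        exact (summable_smul_of_zeroAtInfty hK a).tsum_add (summable_smul_of_zeroAtInfty hK b)
      map_smul' := fun c a => by
        simp only [ZeroAtInftyContinuousMap.smul_apply, smul_assoc, RingHom.id_apply]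
        exact (summable_smul_of_zeroAtInfty hK a).tsum_const_smul c }
    (2 * K) fun a => le_of_tendsto (summable_smul_of_zeroAtInfty hK a).hasSum.norm
      (Eventually.of_forall fun _ =>
        norm_sum_smul_le hK (norm_nonneg a) fun i _ => abs_apply_le_norm a i)

theorem hasSum_zeroAtInftySum [CompleteSpace E] {u : ℕ → E} {K : ℝ}
    (hK : ∀ F : Finset ℕ, ‖∑ i ∈ F, u i‖ ≤ K) (a : ZeroAtInftyContinuousMap ℕ ℝ) :
    HasSum (fun n => a n • u n) (zeroAtInftySum hK a) :=
  (summable_smul_of_zeroAtInfty hK a).hasSum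

theorem norm_sum_comp_le {E : Type*} [NormedAddCommGroup E] {u : ℕ → E} {K : ℝ} (hK : ∀ F : Finset ℕ, ‖∑ i ∈ F, u i‖ ≤ K)
    {σ : ℕ → ℕ} (hσ : Function.Injective σ) (F : Finset ℕ) : ‖∑ i ∈ F, u (σ i)‖ ≤ K := by
  simpa using hK (F.map ⟨σ, hσ⟩)

/-- A weakly unconditionally Cauchy sequence bounded away from zero has a subsequence
spanning a copy of `c₀`. -/
theorem exists_zeroAtInfty_embedding [CompleteSpace E] {u : ℕ → E} {K δ : ℝ}
    (hK : ∀ F : Finset ℕ, ‖∑ i ∈ F, u i‖ ≤ K) (hδ : 0 < δ) (hu : ∀ n, δ ≤ ‖u n‖) :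
    ∃ (T : ZeroAtInftyContinuousMap ℕ ℝ →L[ℝ] E) (c : ℝ), 0 < c ∧
      ∀ a : ZeroAtInftyContinuousMap ℕ ℝ, c * ‖a‖ ≤ ‖T a‖ := by
  have hdual : ∀ n, ∃ φ : E →L[ℝ] ℝ, ‖φ‖ ≤ 1 ∧ φ (u n) = ‖u n‖ := fun n => by
    simpa using exists_dual_vector'' ℝ (u n)
  choose φ hφ hφu using hdual
  have hK0 : 0 ≤ K := by simpa using hK ∅
  have hsum : ∀ k (A : Set ℕ), Summable (A.indicator fun j => |φ k (u j)|) :=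
    fun k A => (summable_abs_dual hK (φ k)).indicator A
  obtain ⟨n, hn⟩ := exists_nat_ge (2 * K / (δ / 2))
  obtain ⟨σ, hσ, hle⟩ := exists_injective_offDiag_le (ε := δ / 2) n
    (fun k A => ∑' j, A.indicator (fun j => |φ k (u j)|) j)
    (fun k A => tsum_nonneg fun j => Set.indicator_nonneg (fun _ _ => abs_nonneg _) _)
    (fun k A B hAB => by
      rw [← (hsum k A).tsum_add (hsum k B), Set.indicator_union_of_disjoint hAB])
    (fun k => by
      rw [div_le_iff₀ (by positivity)] at hn
      refine le_trans ?_ hn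
      refine (hsum k _).tsum_le_of_sum_le fun F => ?_
      calc ∑ j ∈ F, ({k}ᶜ : Set ℕ).indicator (fun j => |φ k (u j)|) j
          ≤ ∑ j ∈ F, |φ k (u j)| := Finset.sum_le_sum fun j _ =>
            Set.indicator_le_self' (fun _ _ => abs_nonneg _) _
        _ ≤ 2 * K * ‖φ k‖ := sum_abs_dual_le hK _ _
        _ ≤ 2 * K := mul_le_of_le_one_right (by positivity) (hφ k))
    (by positivity)
  have hoff : ∀ k (F : Finset ℕ), k ∉ F → ∑ j ∈ F, |φ (σ k) (u (σ j))| ≤ δ / 2 :=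
    fun k F hk => by
      refine le_trans (le_of_eq ?_) (((hsum (σ k) (σ '' {k}ᶜ)).sum_le_tsum (F.map ⟨σ, hσ⟩)
        fun j _ => Set.indicator_nonneg (fun _ _ => abs_nonneg _) _).trans (hle k))
      rw [Finset.sum_map]
      refine Finset.sum_congr rfl fun j hj => ?_
      rw [Set.indicator_of_mem]
      · rfl
      · exact ⟨j, fun h => hk (h ▸ hj), rfl⟩
  have hKσ := norm_sum_comp_le hK hσ
  refine ⟨zeroAtInftySum hKσ, δ / 2, by positivity, fun a => ?_⟩
  set s := zeroAtInftySum hKσ a with hs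
  have hcoord : ∀ k, |a k| * δ ≤ ‖s‖ + ‖a‖ * (δ / 2) := fun k => by
    have hlim : Tendsto (fun F : Finset ℕ =>
        ‖∑ j ∈ F, a j • u (σ j)‖ + ‖a‖ * (δ / 2)) atTop (𝓝 (‖s‖ + ‖a‖ * (δ / 2))) :=
      Tendsto.add_const _ (hasSum_zeroAtInftySum hKσ a).norm
    refine ge_of_tendsto hlim ((eventually_ge_atTop {k}).mono fun F hF => ?_)
    have hkF : k ∈ F := hF (Finset.mem_singleton_self k)
    have h1 : |φ (σ k) (∑ j ∈ F, a j • u (σ j))| ≤ ‖∑ j ∈ F, a j • u (σ j)‖ :=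
      ((φ (σ k)).le_opNorm _).trans (mul_le_of_le_one_left (norm_nonneg _) (hφ _))
    have h2 : φ (σ k) (∑ j ∈ F, a j • u (σ j)) =
        a k * ‖u (σ k)‖ + ∑ j ∈ F.erase k, a j * φ (σ k) (u (σ j)) := by
      rw [map_sum, ← Finset.add_sum_erase F _ hkF]
      simp [hφu]
    have h3 : |∑ j ∈ F.erase k, a j * φ (σ k) (u (σ j))| ≤ ‖a‖ * (δ / 2) := by
      refine (Finset.abs_sum_le_sum_abs _ _).trans ?_
      refine le_trans ?_ (mul_le_mul_of_nonneg_left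
        (hoff k (F.erase k) (Finset.notMem_erase k F)) (norm_nonneg a))
      rw [Finset.mul_sum]
      refine Finset.sum_le_sum fun j _ => ?_
      rw [abs_mul]
      exact mul_le_mul_of_nonneg_right (abs_apply_le_norm a j) (abs_nonneg _)
    have h4 : |a k| * δ ≤ |a k * ‖u (σ k)‖| := by
      rw [abs_mul, abs_norm]
      exact mul_le_mul_of_nonneg_left (hu _) (abs_nonneg _)
    have h5 := abs_sub_abs_le_abs_sub (a k * ‖u (σ k)‖)
      (-∑ j ∈ F.erase k, a j * φ (σ k) (u (σ j)))
    rw [sub_neg_eq_add, ← h2, abs_neg] at h5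
    linarith
  have hnorm : ‖a‖ ≤ (‖s‖ + ‖a‖ * (δ / 2)) / δ := by
    refine (BoundedContinuousFunction.norm_le (f := a.toBCF) (by positivity)).2 fun k => ?_
    rw [le_div_iff₀ hδ]
    exact hcoord k
  rw [le_div_iff₀ hδ] at hnorm
  linarith

/-- **Bessaga–Pełczyński**: a series with bounded finite sums that is not summable yields a
copy of `c₀`. -/
theorem exists_zeroAtInfty_embedding_of_not_summable [CompleteSpace E] {u : ℕ → E} {K : ℝ}
    (hK : ∀ F : Finset ℕ, ‖∑ i ∈ F, u i‖ ≤ K) (hu : ¬ Summable u) :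
    ∃ (T : ZeroAtInftyContinuousMap ℕ ℝ →L[ℝ] E) (c : ℝ), 0 < c ∧
      ∀ a : ZeroAtInftyContinuousMap ℕ ℝ, c * ‖a‖ ≤ ‖T a‖ := by
  rw [summable_iff_vanishing_norm] at hu
  push Not at hu
  obtain ⟨δ, hδ, hu⟩ := hu
  choose t hdisj ht using hu
  let s : ℕ → Finset ℕ := fun n => Nat.rec ∅ (fun _ S => S ∪ t S) n
  have hs : ∀ n, s (n + 1) = s n ∪ t (s n) := fun _ => rfl
  have hmono : Monotone s := monotone_nat_of_le_succ fun n => by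
    rw [hs]
    exact Finset.subset_union_left
  have hlt : ∀ m n, m < n → Disjoint (t (s m)) (t (s n)) := fun m n hmn => by
    refine (Finset.disjoint_of_subset_right ?_ (hdisj (s n))).symm
    exact (Finset.subset_union_right.trans (hs m).ge).trans (hmono hmn)
  have hpw : Pairwise fun m n => Disjoint (t (s m)) (t (s n)) := fun m n hmn =>
    (lt_or_gt_of_ne hmn).elim (hlt m n) fun h => (hlt n m h).symm
  refine exists_zeroAtInfty_embedding (u := fun k => ∑ i ∈ t (s k), u i) (K := K)
    (fun F => ?_) hδ fun n => ht (s n)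
  rw [← Finset.sum_biUnion fun m _ n _ hmn => hpw hmn]
  exact hK _

end WeaklyUnconditionallyCauchy

section BoundedAdditive

/-- Total variation on `A` of an additive set function. -/
noncomputable def setVariation (μ : Set ℕ → ℝ) (A : Set ℕ) : ℝ :=
  ⨆ B : Set ℕ × Set ℕ, (μ (A ∩ B.1) - μ (A ∩ B.2))

variable {μ : Set ℕ → ℝ} {C : ℝ}

theorem sub_le_two_mul_of_abs_le (hC : ∀ A, |μ A| ≤ C) (A B : Set ℕ) :
    μ A - μ B ≤ 2 * C := by
  linarith [(abs_le.1 (hC A)).2, (abs_le.1 (hC B)).1]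

theorem le_setVariation (hC : ∀ A, |μ A| ≤ C) (A B B' : Set ℕ) :
    μ (A ∩ B) - μ (A ∩ B') ≤ setVariation μ A :=
  le_ciSup (f := fun B : Set ℕ × Set ℕ => μ (A ∩ B.1) - μ (A ∩ B.2))
    ⟨2 * C, by rintro _ ⟨B, rfl⟩; exact sub_le_two_mul_of_abs_le hC _ _⟩ (B, B')

theorem setVariation_nonneg (hC : ∀ A, |μ A| ≤ C) (A : Set ℕ) : 0 ≤ setVariation μ A := by
  simpa using le_setVariation hC A ∅ ∅

theorem setVariation_le (hC : ∀ A, |μ A| ≤ C) (A : Set ℕ) : setVariation μ A ≤ 2 * C :=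
  ciSup_le fun _ => sub_le_two_mul_of_abs_le hC _ _

theorem abs_le_setVariation (hC : ∀ A, |μ A| ≤ C) (h0 : μ ∅ = 0) {A B : Set ℕ} (hB : B ⊆ A) :
    |μ B| ≤ setVariation μ A := by
  have h1 := le_setVariation hC A B ∅
  have h2 := le_setVariation hC A ∅ B
  rw [Set.inter_eq_self_of_subset_right hB, Set.inter_empty, h0] at h1 h2
  exact abs_le.2 ⟨by linarith, by linarith⟩

theorem setVariation_add_le (hC : ∀ A, |μ A| ≤ C)
    (hadd : ∀ A B, Disjoint A B → μ (A ∪ B) = μ A + μ B) {A A' : Set ℕ} (hA : Disjoint A A') :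
    setVariation μ A + setVariation μ A' ≤ setVariation μ (A ∪ A') := by
  refine ciSup_add_ciSup_le fun B B' => ?_
  have hsplit : ∀ D D' : Set ℕ,
      μ ((A ∪ A') ∩ ((A ∩ D) ∪ (A' ∩ D'))) = μ (A ∩ D) + μ (A' ∩ D') := fun D D' => by
    rw [Set.inter_eq_self_of_subset_right
      (Set.union_subset_union Set.inter_subset_left Set.inter_subset_left),
      hadd _ _ (hA.mono Set.inter_subset_left Set.inter_subset_left)]
  have h := le_setVariation hC (A ∪ A') ((A ∩ B.1) ∪ (A' ∩ B'.1)) ((A ∩ B.2) ∪ (A' ∩ B'.2))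
  rw [hsplit, hsplit] at h
  linarith

end BoundedAdditive

/-- A bounded finitely additive vector measure on `ℕ` with values in a separable space cannot
have atoms bounded away from zero. -/
theorem not_forall_le_norm_singleton {E : Type*} [NormedAddCommGroup E] [NormedSpace ℝ E]
    [TopologicalSpace.SeparableSpace E] (G : Set ℕ → E) {C δ : ℝ} (hC : ∀ A, ‖G A‖ ≤ C)
    (hadd : ∀ A B, Disjoint A B → G (A ∪ B) = G A + G B) (hδ : 0 < δ) :
    ¬ ∀ n, δ ≤ ‖G {n}‖ := by
  intro hG
  have hdual : ∀ n, ∃ φ : E →L[ℝ] ℝ, ‖φ‖ ≤ 1 ∧ φ (G {n}) = ‖G {n}‖ := fun n => by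
    simpa using exists_dual_vector'' ℝ (G {n})
  choose φ hφ hφu using hdual
  have hle : ∀ k x, |φ k x| ≤ ‖x‖ := fun k x =>
    ((φ k).le_opNorm x).trans (mul_le_of_le_one_left (norm_nonneg _) (hφ k))
  have hμC : ∀ k A, |φ k (G A)| ≤ C := fun k A => (hle k _).trans (hC A)
  have hμadd : ∀ k A B, Disjoint A B → φ k (G (A ∪ B)) = φ k (G A) + φ k (G B) :=
    fun k A B hAB => by rw [hadd A B hAB, map_add]
  have hG0 : G ∅ = 0 := by simpa using hadd ∅ ∅ disjoint_bot_left
  obtain ⟨n, hn⟩ := exists_nat_ge (2 * C / (δ / 4))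
  obtain ⟨σ, hσ, hoff⟩ := exists_injective_offDiag_le (ε := δ / 4) n
    (fun k A => setVariation (fun A => φ k (G A)) A)
    (fun k A => setVariation_nonneg (hμC k) A)
    (fun k A B hAB => setVariation_add_le (hμC k) (hμadd k) hAB)
    (fun k => by
      rw [div_le_iff₀ (by positivity)] at hn
      exact (setVariation_le (hμC k) _).trans hn)
    (by positivity)
  have hsmall : ∀ k (A : Set ℕ), k ∉ A → |φ (σ k) (G (σ '' A))| ≤ δ / 4 := fun k A hk => by
    have hA : σ '' A ⊆ σ '' {k}ᶜ := Set.image_mono (Set.subset_compl_singleton_iff.2 hk)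
    exact (abs_le_setVariation (μ := fun A => φ (σ k) (G A)) (hμC (σ k)) (by simp [hG0]) hA).trans
      (hoff k)
  have hsep : ∀ (A B : Set ℕ) (k : ℕ), k ∈ A → k ∉ B →
      δ / 2 ≤ dist (G (σ '' A)) (G (σ '' B)) := fun A B k hA hB => by
    have h1 : G (σ '' A) = G {σ k} + G (σ '' (A \ {k})) := by
      rw [← hadd, ← Set.image_singleton, ← Set.image_union, Set.union_sdiff_cancel (by simpa)]
      rw [← Set.image_singleton, Set.disjoint_image_iff hσ]
      exact Set.disjoint_sdiff_right
    have h2 := (abs_le.1 (hsmall k (A \ {k}) (by simp))).1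
    have h3 := (abs_le.1 (hsmall k B hB)).2
    have h4 := (le_abs_self _).trans (hle (σ k) (G (σ '' A) - G (σ '' B)))
    rw [map_sub, h1, map_add, hφu, ← h1, ← dist_eq_norm] at h4
    linarith [hG (σ k)]
  have hsep' : ∀ A B : Set ℕ, A ≠ B → δ / 2 ≤ dist (G (σ '' A)) (G (σ '' B)) := fun A B hAB => by
    by_cases h : A ⊆ B
    · obtain ⟨k, hB, hA⟩ := Set.not_subset.1 fun h' => hAB (h.antisymm h')
      rw [dist_comm]
      exact hsep B A k hB hA
    · obtain ⟨k, hA, hB⟩ := Set.not_subset.1 h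
      exact hsep A B k hA hB
  have hcount : Countable (Set ℕ) := by
    refine Pairwise.countable_of_isOpen_disjoint
      (s := fun A : Set ℕ => Metric.ball (G (σ '' A)) (δ / 4)) (fun A B hAB => ?_)
      (fun A => Metric.isOpen_ball) fun A => Metric.nonempty_ball.2 (by positivity)
    exact Metric.ball_disjoint_ball (by linarith [hsep' A B hAB])
  obtain ⟨g, hg⟩ := exists_injective_nat (Set ℕ)
  exact Function.cantor_injective g hg

section AtomicDecomposition

variable {E : Type*} [NormedAddCommGroup E] [NormedSpace ℝ E]

theorem exists_norm_bidual_sum_le [CompleteSpace E] {f : ℕ → E →L[ℝ] ℝ} {v : ℕ → E}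
    (had : ∀ x : E, Summable (fun j => f j x • v j)) :
    ∃ K : ℝ, ∀ (x'' : (E →L[ℝ] ℝ) →L[ℝ] ℝ) (F : Finset ℕ),
      ‖∑ j ∈ F, x'' (f j) • v j‖ ≤ K * ‖x''‖ := by
  obtain ⟨K, hK⟩ := banach_steinhaus
    (g := fun F : Finset ℕ => ∑ j ∈ F, (f j).smulRight (v j)) fun x => by
      obtain ⟨s, hs⟩ := summable_iff_vanishing_norm.1 (had x) 1 one_pos
      refine ⟨∑ j ∈ s, ‖f j x • v j‖ + 1, fun F => ?_⟩
      simp only [sum_apply, ContinuousLinearMap.smulRight_apply]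
      rw [← Finset.sum_inter_add_sum_sdiff F s]
      refine (norm_add_le _ _).trans (add_le_add ?_ (hs _ Finset.sdiff_disjoint).le)
      exact (norm_sum_le _ _).trans (Finset.sum_le_sum_of_subset_of_nonneg
        Finset.inter_subset_right fun _ _ _ => norm_nonneg _)
  have hK0 : 0 ≤ K := (norm_nonneg _).trans (hK ∅)
  refine ⟨K, fun x'' F => NormedSpace.norm_le_dual_bound ℝ _ (by positivity) fun φ => ?_⟩
  have h : φ (∑ j ∈ F, x'' (f j) • v j) =
      x'' (φ.comp (∑ j ∈ F, (f j).smulRight (v j))) := by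
    have : φ.comp (∑ j ∈ F, (f j).smulRight (v j)) = ∑ j ∈ F, φ (v j) • f j := by
      ext x
      simp [mul_comm]
    rw [this]
    simp [mul_comm]
  rw [h]
  calc _ ≤ ‖x''‖ * (‖φ‖ * K) := (x''.le_opNorm _).trans (mul_le_mul_of_nonneg_left
        ((ContinuousLinearMap.opNorm_comp_le _ _).trans
          (mul_le_mul_of_nonneg_left (hK F) (norm_nonneg _))) (norm_nonneg _))
    _ = K * ‖x''‖ * ‖φ‖ := by ring

/-- The functional `φ ↦ ∑_{n ∈ A} φ(uₙ)` in the bidual. -/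
noncomputable def bidualSum {u : ℕ → E} {K : ℝ} (hK : ∀ F : Finset ℕ, ‖∑ i ∈ F, u i‖ ≤ K)
    (A : Set ℕ) : (E →L[ℝ] ℝ) →L[ℝ] ℝ :=
  have hs : ∀ φ : E →L[ℝ] ℝ, Summable (A.indicator fun n => φ (u n)) := fun φ =>
    (summable_abs_dual hK φ).of_abs.indicator A
  LinearMap.mkContinuous
    { toFun := fun φ => ∑' n, A.indicator (fun n => φ (u n)) n
      map_add' := fun φ ψ => by
        rw [← (hs φ).tsum_add (hs ψ)]
        simp only [add_apply, Set.indicator_add]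
      map_smul' := fun c φ => by
        rw [RingHom.id_apply, ← (hs φ).tsum_const_smul c]
        simp only [← Set.indicator_const_smul_apply, smul_apply] }
    (2 * K) fun φ => le_of_tendsto (hs φ).hasSum.norm (Eventually.of_forall fun F => by
      refine (norm_sum_le _ _).trans (le_trans (Finset.sum_le_sum fun i _ => ?_)
        (sum_abs_dual_le hK φ F))
      exact norm_indicator_le_norm_self _ _)

variable {u : ℕ → E} {K : ℝ} (hK : ∀ F : Finset ℕ, ‖∑ i ∈ F, u i‖ ≤ K)

theorem bidualSum_apply (A : Set ℕ) (φ : E →L[ℝ] ℝ) :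
    bidualSum hK A φ = ∑' n, A.indicator (fun n => φ (u n)) n := rfl

theorem norm_bidualSum_le (A : Set ℕ) : ‖bidualSum hK A‖ ≤ 2 * K := by
  unfold bidualSum
  exact LinearMap.mkContinuous_norm_le _ (by linarith [(norm_nonneg _).trans (hK ∅)]) _

theorem bidualSum_union {A B : Set ℕ} (hAB : Disjoint A B) :
    bidualSum hK (A ∪ B) = bidualSum hK A + bidualSum hK B := by
  ext φ
  have hs : ∀ A : Set ℕ, Summable (A.indicator fun n => φ (u n)) := fun A =>
    (summable_abs_dual hK φ).of_abs.indicator A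
  rw [add_apply, bidualSum_apply, bidualSum_apply, bidualSum_apply,
    ← (hs A).tsum_add (hs B), Set.indicator_union_of_disjoint hAB]

theorem bidualSum_singleton (n : ℕ) (φ : E →L[ℝ] ℝ) : bidualSum hK {n} φ = φ (u n) := by
  rw [bidualSum_apply, tsum_eq_single n fun m hm => Set.indicator_of_notMem (by simpa using hm) _]
  simp

/-- In a separable space with a boundedly complete atomic decomposition, no weakly
unconditionally Cauchy sequence is bounded away from zero. -/
theorem not_forall_le_norm_of_boundedlyComplete [CompleteSpace E]
    [TopologicalSpace.SeparableSpace E] {f : ℕ → E →L[ℝ] ℝ} {v : ℕ → E}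
    (hK : ∀ F : Finset ℕ, ‖∑ i ∈ F, u i‖ ≤ K)
    (had : ∀ x : E, HasSum (fun j => f j x • v j) x)
    (hbc : ∀ x'' : (E →L[ℝ] ℝ) →L[ℝ] ℝ,
      ∃ s : E, Tendsto (fun n => ∑ j ∈ Finset.range n, x'' (f j) • v j) atTop (𝓝 s))
    {δ : ℝ} (hδ : 0 < δ) : ¬ ∀ n, δ ≤ ‖u n‖ := by
  intro hu
  choose P hP using hbc
  obtain ⟨M, hM⟩ := exists_norm_bidual_sum_le fun x => (had x).summable
  have hPM : ∀ x'', ‖P x''‖ ≤ M * ‖x''‖ := fun x'' =>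
    le_of_tendsto (hP x'').norm (Eventually.of_forall fun n => hM x'' _)
  have hsing : ∀ n, P (bidualSum hK {n}) = u n := fun n => by
    refine tendsto_nhds_unique (hP _) ?_
    simp only [bidualSum_singleton]
    exact (had (u n)).tendsto_sum_nat
  refine not_forall_le_norm_singleton (fun A => P (bidualSum hK A)) (C := |M| * (2 * K))
    (fun A => ?_) (fun A B hAB => ?_) hδ fun n => by simpa only [hsing] using hu n
  · refine (hPM _).trans ?_
    exact mul_le_mul (le_abs_self M) (norm_bidualSum_le hK A)
      (ContinuousLinearMap.opNorm_nonneg _) (abs_nonneg _)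
  · refine tendsto_nhds_unique (hP _) ?_
    simpa only [bidualSum_union hK hAB, add_apply, add_smul,
      Finset.sum_add_distrib] using (hP (bidualSum hK A)).add (hP (bidualSum hK B))

end AtomicDecomposition

/-- The indicator function of a finite set, as an element of `c₀`. -/
noncomputable def zeroAtInftyIndicator (F : Finset ℕ) : ZeroAtInftyContinuousMap ℕ ℝ where
  toFun := (F : Set ℕ).indicator 1
  continuous_toFun := continuous_of_discreteTopology
  zero_at_infty' := by
    rw [cocompact_eq_cofinite]
    refine tendsto_const_nhds.congr' ?_
    filter_upwards [F.finite_toSet.compl_mem_cofinite] with n hn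
    exact (Set.indicator_of_notMem hn _).symm

theorem zeroAtInftyIndicator_apply (F : Finset ℕ) (n : ℕ) :
    zeroAtInftyIndicator F n = (F : Set ℕ).indicator 1 n := rfl

theorem norm_zeroAtInftyIndicator_le (F : Finset ℕ) : ‖zeroAtInftyIndicator F‖ ≤ 1 := by
  refine (BoundedContinuousFunction.norm_le (f := (zeroAtInftyIndicator F).toBCF)
    zero_le_one).2 fun n => ?_
  exact (norm_indicator_le_norm_self _ _).trans (by simp)

theorem one_le_norm_zeroAtInftyIndicator_singleton (n : ℕ) :
    1 ≤ ‖zeroAtInftyIndicator {n}‖ := by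
  simpa [zeroAtInftyIndicator_apply] using abs_apply_le_norm (zeroAtInftyIndicator {n}) n

theorem sum_zeroAtInftyIndicator_singleton (F : Finset ℕ) :
    ∑ n ∈ F, zeroAtInftyIndicator {n} = zeroAtInftyIndicator F := by
  classical
  induction F using Finset.induction_on with
  | empty =>
    ext m
    simp [zeroAtInftyIndicator_apply]
  | insert n F hn ih =>
    rw [Finset.sum_insert hn, ih]
    ext m
    rw [ZeroAtInftyContinuousMap.add_apply]
    simp only [zeroAtInftyIndicator_apply, Set.indicator_apply, Finset.mem_coe,
      Finset.mem_singleton, Finset.mem_insert, Pi.one_apply]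
    by_cases h : m = n
    · subst h
      simp [hn]
    · simp [h]

/-- For a separable Banach space `E` with an unconditional atomic decomposition
`({x_j'}, {x_j})`, the decomposition is boundedly complete iff `E` contains no subspace
isomorphic to `c₀`. -/
theorem stmt15 {E : Type*} [NormedAddCommGroup E] [NormedSpace ℝ E] [CompleteSpace E]
    [TopologicalSpace.SeparableSpace E]
    (f : ℕ → E →L[ℝ] ℝ) (v : ℕ → E)
    (had : ∀ x : E, HasSum (fun j => f j x • v j) x) :
    (∀ x'' : (E →L[ℝ] ℝ) →L[ℝ] ℝ,
        ∃ s : E, Tendsto (fun n => ∑ j ∈ Finset.range n, x'' (f j) • v j) atTop (𝓝 s)) ↔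
    ¬∃ (T : ZeroAtInftyContinuousMap ℕ ℝ →L[ℝ] E) (c : ℝ), 0 < c ∧
        ∀ a : ZeroAtInftyContinuousMap ℕ ℝ, c * ‖a‖ ≤ ‖T a‖ := by
  constructor
  · rintro hbc ⟨T, c, hc, hT⟩
    refine not_forall_le_norm_of_boundedlyComplete (u := fun n => T (zeroAtInftyIndicator {n}))
      (K := ‖T‖) (fun F => ?_) had hbc hc fun n => ?_
    · rw [← map_sum, sum_zeroAtInftyIndicator_singleton]
      exact (T.le_opNorm _).trans
        (mul_le_of_le_one_right (norm_nonneg _) (norm_zeroAtInftyIndicator_le F))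
    · exact (le_mul_of_one_le_right hc.le (one_le_norm_zeroAtInftyIndicator_singleton n)).trans
        (hT _)
  · intro hc₀ x''
    obtain ⟨K, hK⟩ := exists_norm_bidual_sum_le fun x => (had x).summable
    have hs : Summable fun j => x'' (f j) • v j := by
      by_contra h
      exact hc₀ (exists_zeroAtInfty_embedding_of_not_summable (hK x'') h)
    exact ⟨_, hs.hasSum.tendsto_sum_nat⟩
end

section
/- Let E be a Banach space admitting an unconditional atomic decomposition ({x_j'}, {x_j}). Then the decomposition is shrinking (for every x' ∈ E', ‖∑_{j>n} x'(x_j) x_j'‖ → 0 in E') if and only if E contains no subspace isomorphic to ℓ₁. -/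
open Filter Topology
open scoped ENNReal

/-- **Rosenthal's lemma**: in an infinite nonnegative matrix with uniformly bounded row sums, one
can pass to an infinite square submatrix whose off-diagonal row sums are at most `ε`. -/
theorem exists_injective_tsum_offDiag_le {ε : ℝ≥0∞} (hε : ε ≠ ∞) (n : ℕ) (a : ℕ → ℕ → ℝ≥0∞)
    (ha : ∀ m, ∑' k, a m k ≤ n * ε) :
    ∃ φ : ℕ → ℕ, φ.Injective ∧
      ∀ m, ∑' k, Set.indicator {m}ᶜ (fun k => a (φ m) (φ k)) k ≤ ε := by
  induction n generalizing a with
  | zero =>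
    refine ⟨id, Function.injective_id, fun m => ?_⟩
    calc ∑' k, Set.indicator {m}ᶜ (fun k => a m k) k
        ≤ ∑' k, a m k := ENNReal.tsum_le_tsum fun k => Set.indicator_le_self _ _ k
      _ ≤ ε := (ha m).trans (by simp)
  | succ n ih =>
    by_cases h : ∃ p, ∀ m,
        ∑' k, Set.indicator {m}ᶜ (fun k => a (Nat.pair p m) (Nat.pair p k)) k ≤ ε
    · obtain ⟨p, hp⟩ := h
      exact ⟨Nat.pair p, fun i j hij => (Nat.pair_eq_pair.1 hij).2, hp⟩
    · push Not at h
      choose q hq using h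
      let ψ : ℕ → ℕ := fun p => Nat.pair p (q p)
      have hψ : ψ.Injective := fun i j hij => (Nat.pair_eq_pair.1 hij).1
      obtain ⟨φ, hφ, hle⟩ := ih (fun p r => a (ψ p) (ψ r)) fun p => by
        let e : ℕ ⊕ ({q p}ᶜ : Set ℕ) → ℕ := Sum.elim ψ fun k => Nat.pair p k
        have he : e.Injective := by
          refine hψ.sumElim (fun i j hij => Subtype.ext (Nat.pair_eq_pair.1 hij).2) ?_
          rintro r ⟨k, hk⟩ hrk
          obtain ⟨rfl, rfl⟩ := Nat.pair_eq_pair.1 hrk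
          exact hk rfl
        have hsum : ∑' r, a (ψ p) (ψ r) + ∑' k : ({q p}ᶜ : Set ℕ), a (ψ p) (Nat.pair p k)
            = ∑' x, a (ψ p) (e x) :=
          (HasSum.sum (f := fun x => a (ψ p) (e x)) ENNReal.summable.hasSum
            ENNReal.summable.hasSum).tsum_eq.symm
        have hlt := hq p
        rw [← tsum_subtype] at hlt
        refine (ENNReal.add_le_add_iff_right hε).1 ?_
        calc ∑' r, a (ψ p) (ψ r) + ε
            ≤ ∑' r, a (ψ p) (ψ r) + ∑' k : ({q p}ᶜ : Set ℕ), a (ψ p) (Nat.pair p k) := by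
              gcongr
          _ = ∑' x, a (ψ p) (e x) := hsum
          _ ≤ ∑' k, a (ψ p) k := ENNReal.tsum_comp_le_tsum_of_injective he _
          _ ≤ n * ε + ε := (ha _).trans_eq (by push_cast; ring)
      exact ⟨ψ ∘ φ, hψ.comp hφ, hle⟩

theorem lp_one_hasSum_norm (a : lp (fun _ : ℕ => ℝ) 1) : HasSum (fun n => ‖a n‖) ‖a‖ := by
  simpa using lp.hasSum_norm (by simp) a

/-- A bounded sequence in a Banach space defines an operator on `ℓ₁`. -/
theorem exists_lp_one_clm {F : Type*} [NormedAddCommGroup F] [NormedSpace ℝ F] [CompleteSpace F]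
    (z : ℕ → F) {C : ℝ} (hz : ∀ n, ‖z n‖ ≤ C) :
    ∃ T : lp (fun _ : ℕ => ℝ) 1 →L[ℝ] F, ∀ a, HasSum (fun n => a n • z n) (T a) := by
  have hle (a : lp (fun _ : ℕ => ℝ) 1) (n : ℕ) : ‖a n • z n‖ ≤ C * ‖a n‖ := by
    rw [norm_smul, mul_comm]
    gcongr
    exact hz n
  have hsum (a : lp (fun _ : ℕ => ℝ) 1) : Summable fun n => a n • z n :=
    .of_norm_bounded ((lp_one_hasSum_norm a).summable.mul_left C) (hle a)
  let L : lp (fun _ : ℕ => ℝ) 1 →ₗ[ℝ] F :=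
    { toFun := fun a => ∑' n, a n • z n
      map_add' := fun a b => by
        rw [← (hsum a).tsum_add (hsum b)]
        simp [add_smul]
      map_smul' := fun c a => by
        rw [RingHom.id_apply, ← (hsum a).tsum_const_smul]
        simp [mul_smul] }
  exact ⟨L.mkContinuous C fun a =>
    tsum_of_norm_bounded ((lp_one_hasSum_norm a).mul_left C) (hle a), fun a => (hsum a).hasSum⟩

/-- If `ℓ₁` embeds in `E` via `T`, every bounded sequence of reals is interpolated along the image
of the unit vector basis by a continuous functional on `E`. -/
theorem exists_dual_interpolating {E : Type*} [NormedAddCommGroup E] [NormedSpace ℝ E]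
    (T : lp (fun _ : ℕ => ℝ) 1 →L[ℝ] E) {c : ℝ} (hc : 0 < c) (hT : ∀ a, c * ‖a‖ ≤ ‖T a‖)
    (b : ℕ → ℝ) {C : ℝ} (hb : ∀ n, ‖b n‖ ≤ C) :
    ∃ u : E →L[ℝ] ℝ, ∀ n, u (T (lp.single 1 n 1)) = b n := by
  obtain ⟨B, hB⟩ := exists_lp_one_clm b hb
  have hinj : Function.Injective T.toLinearMap := by
    rw [← LinearMap.ker_eq_bot, LinearMap.ker_eq_bot']
    intro a ha
    have := hT a
    rw [show T a = 0 from ha, norm_zero] at this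
    exact norm_le_zero_iff.1 (nonpos_of_mul_nonpos_right this hc)
  let e := LinearEquiv.ofInjective T.toLinearMap hinj
  let w : LinearMap.range T.toLinearMap →L[ℝ] ℝ :=
    (B.toLinearMap ∘ₗ e.symm.toLinearMap).mkContinuous (‖B‖ * c⁻¹) fun x => by
      obtain ⟨a, rfl⟩ := e.surjective x
      have hle : ‖a‖ ≤ c⁻¹ * ‖e a‖ := (le_inv_mul_iff₀ hc).2 (hT a)
      calc ‖B (e.symm (e a))‖ = ‖B a‖ := by rw [e.symm_apply_apply]
        _ ≤ ‖B‖ * ‖a‖ := B.le_opNorm a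
        _ ≤ ‖B‖ * (c⁻¹ * ‖e a‖) := by gcongr
        _ = ‖B‖ * c⁻¹ * ‖e a‖ := by ring
  obtain ⟨u, hu, -⟩ := exists_extension_norm_eq _ w
  refine ⟨u, fun n => ?_⟩
  calc u (T (lp.single 1 n 1)) = w (e (lp.single 1 n 1)) := hu (e (lp.single 1 n 1))
    _ = B (e.symm (e (lp.single 1 n 1))) := rfl
    _ = B (lp.single 1 n 1) := by rw [e.symm_apply_apply]
    _ = b n := by
      refine (hB _).unique ?_
      convert hasSum_single n fun m hm => ?_ using 1
      · simp
      · simp [hm]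

/-- A shrinking decomposition excludes copies of `ℓ₁`. -/
theorem not_exists_lp_one_embedding_of_shrinking {E : Type*} [NormedAddCommGroup E]
    [NormedSpace ℝ E] (f : ℕ → E →L[ℝ] ℝ) (v : ℕ → E)
    (hs : ∀ u : E →L[ℝ] ℝ,
        Tendsto (fun n => ∑ j ∈ Finset.range n, u (v j) • f j) atTop (𝓝 u)) :
    ¬∃ (T : lp (fun _ : ℕ => ℝ) 1 →L[ℝ] E) (c : ℝ), 0 < c ∧
        ∀ a : lp (fun _ : ℕ => ℝ) 1, c * ‖a‖ ≤ ‖T a‖ := by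
  classical
  rintro ⟨T, c, hc, hT⟩
  let z : ℕ → E := fun n => T (lp.single 1 n 1)
  have hz (n : ℕ) : ‖z n‖ ≤ ‖T‖ := by
    simpa [lp.norm_single] using T.le_opNorm (lp.single 1 n 1)
  obtain ⟨y, -, φ, hφ, hy⟩ :=
    (isCompact_univ_pi fun j => isCompact_closedBall (0 : ℝ) (‖f j‖ * ‖T‖)).tendsto_subseq
      (x := fun n j => f j (z n)) fun n j _ => by
        rw [mem_closedBall_zero_iff]
        exact (f j).le_opNorm_of_le (hz n)
  rw [tendsto_pi_nhds] at hy
  obtain ⟨u, hu⟩ := exists_dual_interpolating T hc hT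
    (fun n => if ∃ k, φ (2 * k) = n then 1 else 0) (C := 1) fun n => by
      split_ifs <;> simp
  have hu_even (k : ℕ) : u (z (φ (2 * k))) = 1 := by
    rw [hu, if_pos ⟨k, rfl⟩]
  have hu_odd (k : ℕ) : u (z (φ (2 * k + 1))) = 0 := by
    rw [hu, if_neg]
    rintro ⟨l, hl⟩
    have := hφ.injective hl
    omega
  obtain ⟨N, hN⟩ := ((Metric.tendsto_nhds.1 (hs u)) (1 / (4 * (‖T‖ + 1))) (by positivity)).exists
  set w : E →L[ℝ] ℝ := ∑ j ∈ Finset.range N, u (v j) • f j with hw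
  have hclose (n : ℕ) : |w (z n) - u (z n)| ≤ 1 / 4 := by
    rw [dist_eq_norm] at hN
    calc |w (z n) - u (z n)| = ‖(w - u) (z n)‖ := rfl
      _ ≤ 1 / (4 * (‖T‖ + 1)) * ‖T‖ := (w - u).le_of_opNorm_le_of_le hN.le (hz n)
      _ ≤ 1 / 4 := by
        rw [div_mul_eq_mul_div, div_le_div_iff₀ (by positivity) (by norm_num)]
        linarith
  have hlim : Tendsto (fun k => w (z (φ k))) atTop (𝓝 (∑ j ∈ Finset.range N, u (v j) • y j)) := by
    simp only [hw, sum_apply, smul_apply]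
    exact tendsto_finsetSum _ fun j _ => (hy j).const_smul _
  have heven : Tendsto (fun k : ℕ => 2 * k) atTop atTop :=
    tendsto_atTop_mono (fun k => show k ≤ _ by omega) tendsto_id
  have hodd : Tendsto (fun k : ℕ => 2 * k + 1) atTop atTop :=
    tendsto_atTop_mono (fun k => show k ≤ _ by omega) tendsto_id
  have hdiff := (hlim.comp heven).sub (hlim.comp hodd)
  rw [sub_self] at hdiff
  have : (1 / 2 : ℝ) ≤ 0 := ge_of_tendsto' hdiff fun k => by
    have h₀ := abs_le.1 (hclose (φ (2 * k)))
    have h₁ := abs_le.1 (hclose (φ (2 * k + 1)))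
    rw [hu_even] at h₀
    rw [hu_odd] at h₁
    simp only [Function.comp_apply]
    linarith [h₀.1, h₁.2]
  norm_num at this

/-- A pointwise absolutely summable sequence of functionals is uniformly so on bounded sets. -/
theorem exists_tsum_enorm_apply_le {E : Type*} [NormedAddCommGroup E] [NormedSpace ℝ E]
    [CompleteSpace E] (h : ℕ → E →L[ℝ] ℝ) (hh : ∀ x, Summable fun j => h j x) :
    ∃ C : ℝ, ∀ x, ∑' j, ‖h j x‖ₑ ≤ ENNReal.ofReal (C * ‖x‖) := by
  obtain ⟨C, hC⟩ := banach_steinhaus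
    (g := fun i : Finset ℕ × (ℕ → SignType) => ∑ j ∈ i.1, (i.2 j : ℝ) • h j) fun x => by
      refine ⟨∑' j, |h j x|, fun i => ?_⟩
      rw [sum_apply]
      calc ‖∑ j ∈ i.1, ((i.2 j : ℝ) • h j) x‖ ≤ ∑ j ∈ i.1, |h j x| := by
            refine norm_sum_le_of_le _ fun j _ => ?_
            rw [smul_apply, norm_smul]
            refine mul_le_of_le_one_left (norm_nonneg _) ?_
            cases i.2 j <;> simp
        _ ≤ ∑' j, |h j x| := (hh x).abs.sum_le_tsum _ fun _ _ => abs_nonneg _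
  refine ⟨C, fun x => ENNReal.summable.tsum_le_of_sum_le fun s => ?_⟩
  simp only [← ofReal_norm]
  rw [← ENNReal.ofReal_sum_of_nonneg fun _ _ => norm_nonneg _]
  refine ENNReal.ofReal_le_ofReal ?_
  calc ∑ j ∈ s, ‖h j x‖ = (∑ j ∈ s, (SignType.sign (h j x) : ℝ) • h j) x := by
        simp [sum_apply, sign_mul_self]
    _ ≤ ‖(∑ j ∈ s, (SignType.sign (h j x) : ℝ) • h j) x‖ := le_abs_self _
    _ ≤ C * ‖x‖ := ContinuousLinearMap.le_of_opNorm_le _ (hC (s, fun j => SignType.sign (h j x))) x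

/-- If `E` has functionals bounded away from zero whose series is uniformly absolutely summable on
the unit ball, then `E` contains a copy of `ℓ₁`. -/
theorem exists_lp_one_embedding_of_tsum_enorm_le {E : Type*} [NormedAddCommGroup E]
    [NormedSpace ℝ E] [CompleteSpace E] (g : ℕ → E →L[ℝ] ℝ) {C δ : ℝ} (hδ : 0 < δ)
    (hg : ∀ k, δ < ‖g k‖) (hC : ∀ x, ∑' k, ‖g k x‖ₑ ≤ ENNReal.ofReal (C * ‖x‖)) :
    ∃ (T : lp (fun _ : ℕ => ℝ) 1 →L[ℝ] E) (c : ℝ), 0 < c ∧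
        ∀ a : lp (fun _ : ℕ => ℝ) 1, c * ‖a‖ ≤ ‖T a‖ := by
  choose x hx hgx using fun k => (g k).exists_lt_apply_of_lt_opNorm (hg k)
  obtain ⟨n, hn⟩ := exists_nat_ge (|C| / (δ / 2))
  rw [div_le_iff₀ (half_pos hδ)] at hn
  obtain ⟨φ, hφ, hoff⟩ := exists_injective_tsum_offDiag_le (ε := ENNReal.ofReal (δ / 2))
    ENNReal.ofReal_ne_top n (fun m k => ‖g k (x m)‖ₑ) fun m => by
      refine (hC _).trans ?_
      rw [← ENNReal.ofReal_natCast, ← ENNReal.ofReal_mul n.cast_nonneg]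
      refine ENNReal.ofReal_le_ofReal (le_trans ?_ hn)
      exact (mul_le_mul_of_nonneg_right (le_abs_self C) (norm_nonneg _)).trans
        (mul_le_of_le_one_right (abs_nonneg C) (hx m).le)
  obtain ⟨T, hT⟩ := exists_lp_one_clm (fun m => x (φ m)) fun m => (hx (φ m)).le
  refine ⟨T, δ / 2 / (|C| + 1), by positivity, fun a => ?_⟩
  have hnorm : ∑' k, ‖a k‖ₑ = ENNReal.ofReal ‖a‖ := by
    rw [← (lp_one_hasSum_norm a).tsum_eq,
      ENNReal.ofReal_tsum_of_nonneg (fun _ => norm_nonneg _) (lp_one_hasSum_norm a).summable]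
    simp only [ofReal_norm]
  have hrow (k : ℕ) : ENNReal.ofReal δ * ‖a k‖ₑ ≤ ‖g (φ k) (T a)‖ₑ +
      ∑' m, ‖a m‖ₑ * Set.indicator {m}ᶜ (fun k => ‖g (φ k) (x (φ m))‖ₑ) k := by
    have hgT : HasSum (fun m => a m * g (φ k) (x (φ m))) (g (φ k) (T a)) := by
      simpa using (g (φ k)).hasSum (hT a)
    have hsplit := hgT.summable.tsum_eq_add_tsum_ite k
    rw [hgT.tsum_eq] at hsplit
    have hdiag := eq_sub_of_add_eq hsplit.symm
    calc ENNReal.ofReal δ * ‖a k‖ₑ ≤ ‖g (φ k) (x (φ k))‖ₑ * ‖a k‖ₑ := by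
          gcongr
          rw [← ofReal_norm]
          exact ENNReal.ofReal_le_ofReal (hgx _).le
      _ = ‖a k * g (φ k) (x (φ k))‖ₑ := by rw [enorm_mul, mul_comm]
      _ ≤ ‖g (φ k) (T a)‖ₑ + ‖∑' m, if m = k then 0 else a m * g (φ k) (x (φ m))‖ₑ := by
          rw [hdiag]
          exact enorm_sub_le
      _ ≤ ‖g (φ k) (T a)‖ₑ + ∑' m, ‖if m = k then 0 else a m * g (φ k) (x (φ m))‖ₑ := by
          gcongr
          exact enorm_tsum_le_tsum_enorm
      _ = _ := by
          congr 1
          refine tsum_congr fun m => ?_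
          by_cases hmk : m = k
          · simp [hmk]
          · simp [hmk, Ne.symm hmk, enorm_mul]
  have htotal : ENNReal.ofReal (δ * ‖a‖) ≤ ENNReal.ofReal (|C| * ‖T a‖ + ‖a‖ * (δ / 2)) :=
    calc ENNReal.ofReal (δ * ‖a‖) = ∑' k, ENNReal.ofReal δ * ‖a k‖ₑ := by
          rw [ENNReal.tsum_mul_left, hnorm, ENNReal.ofReal_mul hδ.le]
      _ ≤ ∑' k, (‖g (φ k) (T a)‖ₑ +
          ∑' m, ‖a m‖ₑ * Set.indicator {m}ᶜ (fun k => ‖g (φ k) (x (φ m))‖ₑ) k) :=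
        ENNReal.tsum_le_tsum hrow
      _ = ∑' k, ‖g (φ k) (T a)‖ₑ +
          ∑' m, ‖a m‖ₑ * ∑' k, Set.indicator {m}ᶜ (fun k => ‖g (φ k) (x (φ m))‖ₑ) k := by
        rw [ENNReal.tsum_add, ENNReal.tsum_comm]
        simp only [ENNReal.tsum_mul_left]
      _ ≤ ENNReal.ofReal (|C| * ‖T a‖) + ∑' m, ‖a m‖ₑ * ENNReal.ofReal (δ / 2) := by
        gcongr with m
        · refine (ENNReal.tsum_comp_le_tsum_of_injective hφ fun k => ‖g k (T a)‖ₑ).trans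
            ((hC _).trans (ENNReal.ofReal_le_ofReal ?_))
          gcongr
          exact le_abs_self C
        · exact hoff m
      _ = ENNReal.ofReal (|C| * ‖T a‖ + ‖a‖ * (δ / 2)) := by
        rw [ENNReal.tsum_mul_right, hnorm, ← ENNReal.ofReal_mul (norm_nonneg _),
          ← ENNReal.ofReal_add (by positivity) (by positivity)]
  rw [ENNReal.ofReal_le_ofReal_iff (by positivity)] at htotal
  rw [div_mul_eq_mul_div, div_le_iff₀ (by positivity)]
  nlinarith [norm_nonneg (T a)]

/-- If a series of functionals converges pointwise unconditionally but is not summable in norm, then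
`E` contains a copy of `ℓ₁`. -/
theorem exists_lp_one_embedding_of_not_summable {E : Type*} [NormedAddCommGroup E]
    [NormedSpace ℝ E] [CompleteSpace E] (h : ℕ → E →L[ℝ] ℝ) (hh : ∀ x, Summable fun j => h j x)
    (hns : ¬Summable h) :
    ∃ (T : lp (fun _ : ℕ => ℝ) 1 →L[ℝ] E) (c : ℝ), 0 < c ∧
        ∀ a : lp (fun _ : ℕ => ℝ) 1, c * ‖a‖ ≤ ‖T a‖ := by
  obtain ⟨C, hC⟩ := exists_tsum_enorm_apply_le h hh
  rw [summable_iff_vanishing_norm] at hns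
  push Not at hns
  obtain ⟨ε, hε, hvan⟩ := hns
  obtain ⟨t, ht, hdisj⟩ := exists_seq_of_forall_finset_exists'
    (fun t : Finset ℕ => ε ≤ ‖∑ j ∈ t, h j‖) Disjoint fun s _ => by
      obtain ⟨t, htd, hte⟩ := hvan (s.biUnion id)
      exact ⟨t, hte, fun r hr => (htd.mono_right (Finset.subset_biUnion_of_mem id hr)).symm⟩
  refine exists_lp_one_embedding_of_tsum_enorm_le (fun k => ∑ j ∈ t k, h j) (half_pos hε)
    (fun k => (half_lt_self hε).trans_le (ht k)) (C := C) fun x => ?_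
  have hinj : Function.Injective fun p : Σ k, t k => (p.2 : ℕ) := by
    rintro ⟨k, i, hi⟩ ⟨l, j, hj⟩ (rfl : i = j)
    obtain rfl : k = l := by
      by_contra hkl
      exact Finset.disjoint_left.1 (hdisj hkl) hi hj
    rfl
  calc ∑' k, ‖(∑ j ∈ t k, h j) x‖ₑ ≤ ∑' k, ∑' j : t k, ‖h j x‖ₑ := by
        refine ENNReal.tsum_le_tsum fun k => ?_
        rw [sum_apply, Finset.tsum_subtype (t k) fun j => ‖h j x‖ₑ]
        exact enorm_sum_le _ _
    _ = ∑' p : Σ k, t k, ‖h p.2 x‖ₑ :=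
        (ENNReal.tsum_sigma' fun p : Σ k, t k => ‖h p.2 x‖ₑ).symm
    _ ≤ ∑' j, ‖h j x‖ₑ := ENNReal.tsum_comp_le_tsum_of_injective hinj fun j => ‖h j x‖ₑ
    _ ≤ ENNReal.ofReal (C * ‖x‖) := hC x

/-- For a Banach space `E` with an unconditional atomic decomposition `({x_j'}, {x_j})`,
the decomposition is shrinking iff `E` contains no subspace isomorphic to `ℓ₁`. -/
theorem stmt16 {E : Type*} [NormedAddCommGroup E] [NormedSpace ℝ E] [CompleteSpace E]
    (f : ℕ → E →L[ℝ] ℝ) (v : ℕ → E)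
    (had : ∀ x : E, HasSum (fun j => f j x • v j) x) :
    (∀ u : E →L[ℝ] ℝ,
        Tendsto (fun n => ∑ j ∈ Finset.range n, u (v j) • f j) atTop (𝓝 u)) ↔
    ¬∃ (T : lp (fun _ : ℕ => ℝ) 1 →L[ℝ] E) (c : ℝ), 0 < c ∧
        ∀ a : lp (fun _ : ℕ => ℝ) 1, c * ‖a‖ ≤ ‖T a‖ := by
  refine ⟨not_exists_lp_one_embedding_of_shrinking f v, fun hno u => ?_⟩
  have hpt (x : E) : HasSum (fun j => (u (v j) • f j) x) (u x) := by
    simpa [mul_comm] using u.hasSum (had x)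
  have hsum : Summable fun j => u (v j) • f j := by
    by_contra hns
    exact hno (exists_lp_one_embedding_of_not_summable _ (fun x => (hpt x).summable) hns)
  have hu : ∑' j, u (v j) • f j = u := by
    ext x
    exact ((ContinuousLinearMap.apply ℝ ℝ x).hasSum hsum.hasSum).unique (hpt x)
  have hlim := hsum.hasSum.tendsto_sum_nat
  rwa [hu] at hlim
end
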